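/- Let λ < 0 and μ > 0 be real numbers, and suppose a sequence {w_n} in H^2(R^N) satisfies ||Δw_n||_2² − μ||∇w_n||_2² − λ||w_n||_2² → 0 as n → ∞, with ||Δw_n||_2² ≥ δ and ||w_n||_2² ≥ δ for some δ > 0 and all n. Then λ ≥ −μ²/4. -/

import Mathlib

open MeasureTheory Filter Topology

noncomputable def lapl {N : ℕ} (u : EuclideanSpace ℝ (Fin N) → ℝ)
    (x : EuclideanSpace ℝ (Fin N)) : ℝ :=
  ∑ i : Fin N, iteratedFDeriv ℝ 2 u x ![EuclideanSpace.single i 1, EuclideanSpace.single i 1]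

theorem exists_seq_cutoff (E : Type*) [NormedAddCommGroup E] [InnerProductSpace ℝ E]
    [FiniteDimensional ℝ E] :
    ∃ (η : ℕ → E → ℝ) (C : ℝ), (∀ k, ContDiff ℝ 1 (η k)) ∧ (∀ k, HasCompactSupport (η k)) ∧
      (∀ k x, |η k x| ≤ 1) ∧ (∀ x, Tendsto (fun k => η k x) atTop (𝓝 1)) ∧
      (∀ k x, ‖fderiv ℝ (η k) x‖ ≤ C) ∧
      (∀ x, Tendsto (fun k => fderiv ℝ (η k) x) atTop (𝓝 0)) := by
  let φ : ContDiffBump (0 : E) := ⟨1, 2, by norm_num, by norm_num⟩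
  have hφ : ContDiff ℝ 1 φ := φ.contDiff
  obtain ⟨C, hC⟩ : ∃ C, ∀ x, ‖fderiv ℝ φ x‖ ≤ C :=
    (hφ.continuous_fderiv one_ne_zero).bounded_above_of_compact_support
      (φ.hasCompactSupport.fderiv ℝ)
  have hr : Tendsto (fun k : ℕ => ((k : ℝ) + 1)⁻¹) atTop (𝓝 0) := by
    simpa using tendsto_one_div_add_atTop_nhds_zero_nat (𝕜 := ℝ)
  have hpos (k : ℕ) : 0 < ((k : ℝ) + 1)⁻¹ := by positivity
  have hD (k : ℕ) (x : E) : ‖fderiv ℝ (fun y => φ (((k : ℝ) + 1)⁻¹ • y)) x‖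
      ≤ ((k : ℝ) + 1)⁻¹ * C := by
    rw [fderiv_comp_smul, norm_smul, Real.norm_of_nonneg (hpos k).le]
    gcongr
    exact hC _
  have hC0 : 0 ≤ C := (norm_nonneg _).trans (hC 0)
  refine ⟨fun k x => φ (((k : ℝ) + 1)⁻¹ • x), C, fun k => ?_, fun k => ?_, fun k x => ?_,
    fun x => ?_, fun k x => ?_, fun x => ?_⟩
  · exact hφ.comp (contDiff_id.const_smul _)
  · exact φ.hasCompactSupport.comp_smul (hpos k).ne'
  · rw [abs_of_nonneg φ.nonneg]
    exact φ.le_one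
  · have h : Tendsto (fun k : ℕ => φ (((k : ℝ) + 1)⁻¹ • x)) atTop (𝓝 (φ ((0 : ℝ) • x))) :=
      (hφ.continuous.tendsto _).comp (hr.smul_const x)
    rwa [zero_smul, φ.eventuallyEq_one.eq_of_nhds] at h
  · refine (hD k x).trans (mul_le_of_le_one_left hC0 (inv_le_one_of_one_le₀ ?_))
    linarith [k.cast_nonneg (α := ℝ)]
  · refine squeeze_zero_norm (fun k => hD k x) ?_
    simpa using hr.mul_const C

theorem gradient_apply {N : ℕ} {u : EuclideanSpace ℝ (Fin N) → ℝ}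
    (x : EuclideanSpace ℝ (Fin N)) (i : Fin N) :
    gradient u x i = fderiv ℝ u x (EuclideanSpace.single i 1) := by
  rw [← toDual_gradient, InnerProductSpace.toDual_apply_apply, EuclideanSpace.inner_single_right]
  simp

theorem clm_apply_eq_sum {N : ℕ} (L : EuclideanSpace ℝ (Fin N) →L[ℝ] ℝ)
    (v : EuclideanSpace ℝ (Fin N)) :
    L v = ∑ i, L (EuclideanSpace.single i 1) * v i := by
  conv_lhs => rw [← (EuclideanSpace.basisFun (Fin N) ℝ).sum_repr v]
  simp [mul_comm]

theorem contDiff_fderiv_apply {N : ℕ} {u : EuclideanSpace ℝ (Fin N) → ℝ} (hu : ContDiff ℝ 2 u)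
    (v : EuclideanSpace ℝ (Fin N)) : ContDiff ℝ 1 (fun x => fderiv ℝ u x v) :=
  (hu.fderiv_right (m := 1) (by norm_num)).clm_apply contDiff_const

theorem lapl_eq_sum_fderiv {N : ℕ} {u : EuclideanSpace ℝ (Fin N) → ℝ} (hu : ContDiff ℝ 2 u)
    (x : EuclideanSpace ℝ (Fin N)) :
    lapl u x = ∑ i, fderiv ℝ (fun y => fderiv ℝ u y (EuclideanSpace.single i 1)) x
      (EuclideanSpace.single i 1) := by
  have h : DifferentiableAt ℝ (fderiv ℝ u) x :=
    (hu.fderiv_right (m := 1) (by norm_num)).differentiable one_ne_zero x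
  simp only [lapl, iteratedFDeriv_two_apply]
  refine Finset.sum_congr rfl fun i _ => ?_
  rw [fderiv_clm_apply h (differentiableAt_const _)]
  simp

theorem continuous_lapl {N : ℕ} {u : EuclideanSpace ℝ (Fin N) → ℝ} (hu : ContDiff ℝ 2 u) :
    Continuous (lapl u) := by
  rw [funext (lapl_eq_sum_fderiv hu)]
  exact continuous_finsetSum _ fun i _ =>
    ((contDiff_fderiv_apply hu _).continuous_fderiv one_ne_zero).clm_apply continuous_const

theorem continuous_gradient {N : ℕ} {u : EuclideanSpace ℝ (Fin N) → ℝ} (hu : ContDiff ℝ 2 u) :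
    Continuous (gradient u) :=
  (InnerProductSpace.toDual ℝ _).symm.continuous.comp (hu.continuous_fderiv two_ne_zero)

theorem integral_cutoff_mul_lapl {N : ℕ} {u η : EuclideanSpace ℝ (Fin N) → ℝ}
    (hu : ContDiff ℝ 2 u) (hη : ContDiff ℝ 1 η) (hs : HasCompactSupport η) :
    ∫ x, η x * (u x * lapl u x) =
      -∫ x, (η x * ‖gradient u x‖ ^ 2 + u x * fderiv ℝ η x (gradient u x)) := by
  have hu1 : ContDiff ℝ 1 u := hu.of_le (by norm_num)
  have hf : ContDiff ℝ 1 (fun x => η x * u x) := hη.mul hu1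
  have hfs : HasCompactSupport (fun x => η x * u x) := hs.mul_right
  have hf's (v) : HasCompactSupport (fun x => fderiv ℝ (fun x => η x * u x) x v) :=
    hfs.fderiv_apply ℝ v
  have hf'c (v) : Continuous (fun x => fderiv ℝ (fun x => η x * u x) x v) :=
    (hf.continuous_fderiv one_ne_zero).clm_apply continuous_const
  have hg (i : Fin N) := contDiff_fderiv_apply hu (EuclideanSpace.single i 1)
  have hg'c (i : Fin N) : Continuous (fun x => fderiv ℝ
      (fun y => fderiv ℝ u y (EuclideanSpace.single i 1)) x (EuclideanSpace.single i 1)) :=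
    ((hg i).continuous_fderiv one_ne_zero).clm_apply continuous_const
  have hi1 (i : Fin N) : Integrable (fun x => fderiv ℝ (fun x => η x * u x) x
      (EuclideanSpace.single i 1) * fderiv ℝ u x (EuclideanSpace.single i 1)) :=
    ((hf'c _).mul (hg i).continuous).integrable_of_hasCompactSupport (hf's _).mul_right
  have hi2 (i : Fin N) : Integrable (fun x => η x * u x * fderiv ℝ
      (fun y => fderiv ℝ u y (EuclideanSpace.single i 1)) x (EuclideanSpace.single i 1)) :=
    (hf.continuous.mul (hg'c i)).integrable_of_hasCompactSupport hfs.mul_right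
  have key (i : Fin N) := integral_mul_fderiv_eq_neg_fderiv_mul_of_integrable (hi1 i) (hi2 i)
    ((hf.continuous.mul (hg i).continuous).integrable_of_hasCompactSupport hfs.mul_right)
    (fun x _ => hf.differentiable one_ne_zero x)
    (fun x _ => (hg i).differentiable one_ne_zero x)
  calc ∫ x, η x * (u x * lapl u x)
      = ∫ x, ∑ i, η x * u x * fderiv ℝ
          (fun y => fderiv ℝ u y (EuclideanSpace.single i 1)) x (EuclideanSpace.single i 1) := by
        simp only [lapl_eq_sum_fderiv hu, Finset.mul_sum, mul_assoc]
    _ = -∫ x, ∑ i, fderiv ℝ (fun x => η x * u x) x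
          (EuclideanSpace.single i 1) * fderiv ℝ u x (EuclideanSpace.single i 1) := by
        rw [integral_finsetSum _ fun i _ => hi2 i, integral_finsetSum _ fun i _ => hi1 i,
          ← Finset.sum_neg_distrib]
        exact Finset.sum_congr rfl fun i _ => key i
    _ = _ := by
        congr 2 with x
        rw [clm_apply_eq_sum, EuclideanSpace.real_norm_sq_eq, Finset.mul_sum, Finset.mul_sum,
          ← Finset.sum_add_distrib]
        refine Finset.sum_congr rfl fun i _ => ?_
        rw [fderiv_fun_mul (hη.differentiable one_ne_zero x) (hu1.differentiable one_ne_zero x),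
          gradient_apply]
        simp only [add_apply, smul_apply, smul_eq_mul]
        ring

theorem integrable_mul_lapl {N : ℕ} {u : EuclideanSpace ℝ (Fin N) → ℝ} (hu : ContDiff ℝ 2 u)
    (h0 : Integrable (fun x => u x ^ 2)) (h2 : Integrable (fun x => lapl u x ^ 2)) :
    Integrable (fun x => u x * lapl u x) :=
  ((memLp_two_iff_integrable_sq hu.continuous.aestronglyMeasurable).2 h0).integrable_mul
    ((memLp_two_iff_integrable_sq (continuous_lapl hu).aestronglyMeasurable).2 h2)

theorem integral_mul_lapl {N : ℕ} {u : EuclideanSpace ℝ (Fin N) → ℝ} (hu : ContDiff ℝ 2 u)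
    (h0 : Integrable (fun x => u x ^ 2)) (h1 : Integrable (fun x => ‖gradient u x‖ ^ 2))
    (h2 : Integrable (fun x => lapl u x ^ 2)) :
    ∫ x, u x * lapl u x = -∫ x, ‖gradient u x‖ ^ 2 := by
  obtain ⟨η, C, hη, hs, hb, hlim, hDb, hDlim⟩ := exists_seq_cutoff (EuclideanSpace ℝ (Fin N))
  have hi := integrable_mul_lapl hu h0 h2
  have hC0 : 0 ≤ C := (norm_nonneg _).trans (hDb 0 0)
  have hG := continuous_gradient hu
  have lhs : Tendsto (fun k => ∫ x, η k x * (u x * lapl u x)) atTop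
      (𝓝 (∫ x, u x * lapl u x)) := by
    refine tendsto_integral_of_dominated_convergence (fun x => ‖u x * lapl u x‖)
      (fun k => ((hη k).continuous.mul
        (hu.continuous.mul (continuous_lapl hu))).aestronglyMeasurable) hi.norm
      (fun k => ae_of_all _ fun x => ?_) (ae_of_all _ fun x => ?_)
    · rw [norm_mul]
      exact mul_le_of_le_one_left (norm_nonneg _) (hb k x)
    · simpa using (hlim x).mul_const (u x * lapl u x)
  have rhs : Tendsto
      (fun k => ∫ x, (η k x * ‖gradient u x‖ ^ 2 + u x * fderiv ℝ (η k) x (gradient u x)))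
      atTop (𝓝 (∫ x, ‖gradient u x‖ ^ 2)) := by
    refine tendsto_integral_of_dominated_convergence
      (fun x => ‖gradient u x‖ ^ 2 + C * (u x ^ 2 + ‖gradient u x‖ ^ 2))
      (fun k => (((hη k).continuous.mul (hG.norm.pow 2)).add (hu.continuous.mul
        (((hη k).continuous_fderiv one_ne_zero).clm_apply hG))).aestronglyMeasurable)
      (h1.add ((h0.add h1).const_mul C))
      (fun k => ae_of_all _ fun x => ?_) (ae_of_all _ fun x => ?_)
    · refine (norm_add_le _ _).trans (add_le_add ?_ ?_)
      · rw [norm_mul, Real.norm_of_nonneg (sq_nonneg ‖gradient u x‖)]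
        exact mul_le_of_le_one_left (sq_nonneg _) (hb k x)
      · rw [norm_mul]
        calc ‖u x‖ * ‖fderiv ℝ (η k) x (gradient u x)‖
            ≤ ‖u x‖ * (C * ‖gradient u x‖) := by
              gcongr
              exact (fderiv ℝ (η k) x).le_of_opNorm_le (hDb k x) _
          _ = C * (‖u x‖ * ‖gradient u x‖) := by ring
          _ ≤ C * (u x ^ 2 + ‖gradient u x‖ ^ 2) := by
              gcongr
              rw [← sq_abs (u x), ← Real.norm_eq_abs]
              nlinarith [sq_nonneg (‖u x‖ - ‖gradient u x‖), sq_nonneg ‖u x‖,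
                sq_nonneg ‖gradient u x‖]
    · simpa using ((hlim x).mul_const (‖gradient u x‖ ^ 2)).add
        ((((ContinuousLinearMap.apply ℝ ℝ (gradient u x)).continuous.tendsto _).comp
          (hDlim x)).const_mul (u x))
  refine tendsto_nhds_unique lhs ?_
  simpa only [integral_cutoff_mul_lapl hu (hη _) (hs _)] using rhs.neg

theorem mul_integral_gradient_le {N : ℕ} {u : EuclideanSpace ℝ (Fin N) → ℝ} (μ : ℝ)
    (hu : ContDiff ℝ 2 u) (h0 : Integrable (fun x => u x ^ 2))
    (h1 : Integrable (fun x => ‖gradient u x‖ ^ 2)) (h2 : Integrable (fun x => lapl u x ^ 2)) :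
    μ * ∫ x, ‖gradient u x‖ ^ 2 ≤ (∫ x, lapl u x ^ 2) + μ ^ 2 / 4 * ∫ x, u x ^ 2 := by
  have hnonneg : 0 ≤ ∫ x, (lapl u x + μ / 2 * u x) ^ 2 := integral_nonneg fun x => sq_nonneg _
  have hexp : ∫ x, (lapl u x + μ / 2 * u x) ^ 2 =
      (∫ x, lapl u x ^ 2) + μ * (∫ x, u x * lapl u x) + μ ^ 2 / 4 * ∫ x, u x ^ 2 := by
    have hi := (integrable_mul_lapl hu h0 h2).const_mul μ
    have hadd : Integrable (fun x => lapl u x ^ 2 + μ * (u x * lapl u x)) := h2.add hi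
    rw [← integral_const_mul, ← integral_const_mul, ← integral_add h2 hi,
      ← integral_add hadd (h0.const_mul _)]
    congr 1 with x
    ring
  rw [hexp, integral_mul_lapl hu h0 h1 h2] at hnonneg
  linarith

theorem stmt_12 {N : ℕ} (w : ℕ → EuclideanSpace ℝ (Fin N) → ℝ) (μ lam δ : ℝ)
    (hμ : 0 < μ) (hlam : lam < 0) (hδ : 0 < δ)
    (hw : ∀ n, ContDiff ℝ 2 (w n))
    (hi : ∀ n, Integrable (fun x => (w n x) ^ 2) ∧
      Integrable (fun x => ‖gradient (w n) x‖ ^ 2) ∧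
      Integrable (fun x => (lapl (w n) x) ^ 2))
    (hconv : Tendsto (fun n => (∫ x, (lapl (w n) x) ^ 2)
        - μ * (∫ x, ‖gradient (w n) x‖ ^ 2) - lam * (∫ x, (w n x) ^ 2)) atTop (𝓝 0))
    (hlb1 : ∀ n, δ ≤ ∫ x, (lapl (w n) x) ^ 2)
    (hlb2 : ∀ n, δ ≤ ∫ x, (w n x) ^ 2) :
    -μ ^ 2 / 4 ≤ lam := by
  by_contra! hlt
  have hgap : 0 < (-lam - μ ^ 2 / 4) * δ := mul_pos (by linarith) hδ
  obtain ⟨n, hn⟩ := (hconv.eventually (gt_mem_nhds hgap)).exists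
  obtain ⟨h0, h1, h2⟩ := hi n
  have hle := mul_integral_gradient_le μ (hw n) h0 h1 h2
  have hlow := mul_le_mul_of_nonneg_left (hlb2 n) (by linarith : 0 ≤ -lam - μ ^ 2 / 4)
  linarith
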